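/- Let n ≥ 1 and let φ be a group automorphism of the n-qubit real Pauli group P_n that fixes both I^{⊗(n−1)} ⊗ Z and I^{⊗(n−1)} ⊗ X (the matrices with Z, respectively X, in the last tensor factor and the 2×2 identity elsewhere). Then there exists a group automorphism φ'' of the (n−1)-qubit real Pauli group P_{n−1} such that φ(R ⊗ S) = φ''(R) ⊗ S for every R ∈ P_{n−1} and every S ∈ {I, X, Z, XZ}. -/

import Mathlib

open Matrix

noncomputable section

namespace RealStab

abbrev Mat (n : ℕ) := Matrix (Fin n → Fin 2) (Fin n → Fin 2) ℝ

/-- The real Pauli matrix `X`. -/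
def X2 : Matrix (Fin 2) (Fin 2) ℝ := !![0, 1; 1, 0]

/-- The real Pauli matrix `Z`. -/
def Z2 : Matrix (Fin 2) (Fin 2) ℝ := !![1, 0; 0, -1]

/-- The set `{I, X, Z, XZ}` of single-qubit Pauli matrices. -/
def pauliSet : Set (Matrix (Fin 2) (Fin 2) ℝ) := {1, X2, Z2, X2 * Z2}

/-- The `n`-fold Kronecker (tensor) product `P 0 ⊗ ⋯ ⊗ P (n-1)`, represented as a
matrix indexed by functions `Fin n → Fin 2` (a `2^n × 2^n` matrix). -/
def tensorN {n : ℕ} (P : Fin n → Matrix (Fin 2) (Fin 2) ℝ) : Mat n :=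
  Matrix.of fun x y => ∏ i, P i (x i) (y i)

/-- The `n`-qubit real Pauli group `P_n`, as a set of `2^n × 2^n` real matrices. -/
def PauliGroup (n : ℕ) : Set (Mat n) :=
  { M | ∃ a : Fin 2, ∃ P : Fin n → Matrix (Fin 2) (Fin 2) ℝ,
      (∀ i, P i ∈ pauliSet) ∧ M = (-1 : ℝ) ^ (a : ℕ) • tensorN P }


/-- `I ⊗ ⋯ ⊗ I ⊗ X` (X on the last qubit). -/
def lastX (n : ℕ) : Mat n := tensorN (fun j => if (j : ℕ) = n - 1 then X2 else 1)

/-- `I ⊗ ⋯ ⊗ I ⊗ Z` (Z on the last qubit). -/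
def lastZ (n : ℕ) : Mat n := tensorN (fun j => if (j : ℕ) = n - 1 then Z2 else 1)

/-- The Kronecker product `V ⊗ S` of an `(n−1)`-qubit matrix `V` with a single-qubit
matrix `S`, as an `n`-qubit matrix (for `n ≥ 1`). -/
def kronLast {n : ℕ} (hn : 1 ≤ n) (V : Mat (n - 1)) (S : Matrix (Fin 2) (Fin 2) ℝ) :
    Mat n :=
  Matrix.of fun x y =>
    V (fun i => x (Fin.castLE (Nat.sub_le n 1) i)) (fun i => y (Fin.castLE (Nat.sub_le n 1) i)) *
      S (x ⟨n - 1, by omega⟩) (y ⟨n - 1, by omega⟩)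

/-- The `n`-qubit real Pauli group as a subgroup of the units of the matrix ring
(the subgroup generated by — equivalently, consisting of — the Pauli matrices). -/
def PauliUnits (n : ℕ) : Subgroup (Mat n)ˣ :=
  Subgroup.closure { U : (Mat n)ˣ | (U : Mat n) ∈ PauliGroup n }

/-- The last-qubit splitting of the basis labels of `m + 1` qubits. -/
def splitLast (m : ℕ) : (Fin (m + 1) → Fin 2) ≃ (Fin m → Fin 2) × Fin 2 :=
  (Fin.snocEquiv fun _ => Fin 2).symm.trans (Equiv.prodComm _ _)

open scoped Kronecker in
theorem kronLast_eq_submatrix {m : ℕ} (hn : 1 ≤ m + 1) (A : Mat m)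
    (S : Matrix (Fin 2) (Fin 2) ℝ) :
    kronLast hn A S = (A ⊗ₖ S).submatrix (splitLast m) (splitLast m) :=
  rfl

theorem kronLast_mul {m : ℕ} (hn : 1 ≤ m + 1) (A B : Mat m) (S T : Matrix (Fin 2) (Fin 2) ℝ) :
    kronLast hn (A * B) (S * T) = kronLast hn A S * kronLast hn B T := by
  simp only [kronLast_eq_submatrix]
  rw [Matrix.submatrix_mul_equiv, Matrix.mul_kronecker_mul]

theorem kronLast_one {m : ℕ} (hn : 1 ≤ m + 1) : kronLast hn (1 : Mat m) 1 = 1 := by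
  rw [kronLast_eq_submatrix, Matrix.one_kronecker_one, Matrix.submatrix_one_equiv]

theorem smul_kronLast {m : ℕ} (hn : 1 ≤ m + 1) (c : ℝ) (A : Mat m)
    (S : Matrix (Fin 2) (Fin 2) ℝ) :
    kronLast hn (c • A) S = c • kronLast hn A S := by
  rw [kronLast_eq_submatrix, Matrix.smul_kronecker, Matrix.submatrix_smul]
  rfl

theorem kronLast_apply_splitLast {m : ℕ} (hn : 1 ≤ m + 1) (A : Mat m)
    (S : Matrix (Fin 2) (Fin 2) ℝ) (x y : Fin m → Fin 2) (i j : Fin 2) :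
    kronLast hn A S ((splitLast m).symm (x, i)) ((splitLast m).symm (y, j)) = A x y * S i j := by
  simp [kronLast_eq_submatrix, Matrix.kroneckerMap_apply]

theorem kronLast_one_right_injective {m : ℕ} (hn : 1 ≤ m + 1) {A B : Mat m}
    (h : kronLast hn A 1 = kronLast hn B 1) : A = B := by
  ext x y
  have := congr_fun₂ h ((splitLast m).symm (x, 0)) ((splitLast m).symm (y, 0))
  simpa [kronLast_apply_splitLast] using this

theorem kronLast_right_injective {m : ℕ} (hn : 1 ≤ m + 1) {A : Mat m} (hA : A ≠ 0)
    {S T : Matrix (Fin 2) (Fin 2) ℝ} (h : kronLast hn A S = kronLast hn A T) : S = T := by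
  obtain ⟨x, y, hxy⟩ : ∃ x y, A x y ≠ 0 := by
    by_contra! h0
    exact hA (Matrix.ext h0)
  ext i j
  have := congr_fun₂ h ((splitLast m).symm (x, i)) ((splitLast m).symm (y, j))
  simpa [kronLast_apply_splitLast, hxy] using this

theorem tensorN_succ {m : ℕ} (hn : 1 ≤ m + 1) (P : Fin (m + 1) → Matrix (Fin 2) (Fin 2) ℝ) :
    tensorN P = kronLast hn (tensorN fun i => P i.castSucc) (P (Fin.last m)) := by
  ext x y
  exact Fin.prod_univ_castSucc _

theorem tensorN_mul {n : ℕ} (P Q : Fin n → Matrix (Fin 2) (Fin 2) ℝ) :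
    tensorN P * tensorN Q = tensorN fun i => P i * Q i := by
  ext x y
  simp only [tensorN, Matrix.mul_apply, Matrix.of_apply, Finset.prod_univ_sum,
    Fintype.piFinset_univ, Finset.prod_mul_distrib]

theorem tensorN_smul {n : ℕ} (c : Fin n → ℝ) (P : Fin n → Matrix (Fin 2) (Fin 2) ℝ) :
    (tensorN fun i => c i • P i) = (∏ i, c i) • tensorN P := by
  ext x y
  simp [tensorN, Finset.prod_mul_distrib]

theorem tensorN_one {n : ℕ} : tensorN (fun _ : Fin n => 1) = 1 := by
  ext x y
  simp only [tensorN, Matrix.of_apply, Matrix.one_apply, Finset.prod_boole, funext_iff]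
  simp

theorem lastX_succ {m : ℕ} (hn : 1 ≤ m + 1) : lastX (m + 1) = kronLast hn 1 X2 := by
  rw [lastX, tensorN_succ hn, ← tensorN_one]
  simp [Fin.is_lt, Nat.ne_of_lt]

theorem lastZ_succ {m : ℕ} (hn : 1 ≤ m + 1) : lastZ (m + 1) = kronLast hn 1 Z2 := by
  rw [lastZ, tensorN_succ hn, ← tensorN_one]
  simp [Fin.is_lt, Nat.ne_of_lt]

theorem X2_mul_X2 : X2 * X2 = 1 := by
  simp [X2, Matrix.one_fin_two]

theorem Z2_mul_Z2 : Z2 * Z2 = 1 := by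
  simp [Z2, Matrix.one_fin_two]

theorem Z2_mul_X2 : Z2 * X2 = -(X2 * Z2) := by
  simp [X2, Z2]

theorem X2_mul_Z2_ne_neg : X2 * Z2 ≠ -(X2 * Z2) := by
  intro h
  have := congr_fun₂ h 0 1
  norm_num [X2, Z2] at this

theorem pauliSet_mul {S T : Matrix (Fin 2) (Fin 2) ℝ} (hS : S ∈ pauliSet) (hT : T ∈ pauliSet) :
    ∃ c : ℝ, (c = 1 ∨ c = -1) ∧ ∃ U ∈ pauliSet, S * T = c • U := by
  have hX : ∀ A, X2 * (X2 * A) = A := fun A => by rw [← mul_assoc, X2_mul_X2, one_mul]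
  have hZX : ∀ A, Z2 * (X2 * A) = -(X2 * (Z2 * A)) := fun A => by
    rw [← mul_assoc, Z2_mul_X2, neg_mul, mul_assoc]
  rcases hS with rfl | rfl | rfl | rfl <;> rcases hT with rfl | rfl | rfl | rfl <;>
    simp [pauliSet, mul_assoc, hX, hZX, X2_mul_X2, Z2_mul_Z2, Z2_mul_X2, or_and_right, exists_or]

theorem pauliSet_mul_self {S : Matrix (Fin 2) (Fin 2) ℝ} (hS : S ∈ pauliSet) :
    ∃ c : ℝ, (c = 1 ∨ c = -1) ∧ S * S = c • 1 := by
  have hZX : ∀ A, Z2 * (X2 * A) = -(X2 * (Z2 * A)) := fun A => by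
    rw [← mul_assoc, Z2_mul_X2, neg_mul, mul_assoc]
  rcases hS with rfl | rfl | rfl | rfl <;>
    simp [mul_assoc, hZX, X2_mul_X2, Z2_mul_Z2, or_and_right, exists_or]

theorem eq_one_of_mem_pauliSet_of_commute {S : Matrix (Fin 2) (Fin 2) ℝ} (hS : S ∈ pauliSet)
    (hX : S * X2 = X2 * S) (hZ : S * Z2 = Z2 * S) : S = 1 := by
  rcases hS with rfl | rfl | rfl | rfl
  · rfl
  · rw [Z2_mul_X2] at hZ
    exact (X2_mul_Z2_ne_neg hZ).elim
  · rw [Z2_mul_X2] at hX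
    exact (X2_mul_Z2_ne_neg hX.symm).elim
  · have h := congr_fun₂ hX 0 0
    norm_num [X2, Z2] at h

theorem prod_eq_one_or_neg_one {n : ℕ} {c : Fin n → ℝ} (hc : ∀ i, c i = 1 ∨ c i = -1) :
    ∏ i, c i = 1 ∨ ∏ i, c i = -1 :=
  Finset.prod_induction c (fun r => r = 1 ∨ r = -1)
    (by rintro _ _ (rfl | rfl) (rfl | rfl) <;> simp) (Or.inl rfl) fun i _ => hc i

theorem mem_PauliGroup_iff {n : ℕ} {M : Mat n} :
    M ∈ PauliGroup n ↔ ∃ c : ℝ, (c = 1 ∨ c = -1) ∧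
      ∃ P : Fin n → Matrix (Fin 2) (Fin 2) ℝ, (∀ i, P i ∈ pauliSet) ∧ M = c • tensorN P := by
  simp [PauliGroup, Fin.exists_fin_two, or_and_right, exists_or]

theorem one_mem_PauliGroup {n : ℕ} : (1 : Mat n) ∈ PauliGroup n :=
  mem_PauliGroup_iff.2 ⟨1, Or.inl rfl, fun _ => 1, fun _ => Or.inl rfl, by
    rw [tensorN_one, one_smul]⟩

theorem mul_mem_PauliGroup {n : ℕ} {M N : Mat n} (hM : M ∈ PauliGroup n)
    (hN : N ∈ PauliGroup n) : M * N ∈ PauliGroup n := by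
  obtain ⟨a, ha, P, hP, rfl⟩ := mem_PauliGroup_iff.1 hM
  obtain ⟨b, hb, Q, hQ, rfl⟩ := mem_PauliGroup_iff.1 hN
  choose c hc U hU h using fun i => pauliSet_mul (hP i) (hQ i)
  refine mem_PauliGroup_iff.2 ⟨a * b * ∏ i, c i, ?_, U, hU, ?_⟩
  · rcases ha with rfl | rfl <;> rcases hb with rfl | rfl <;>
      rcases prod_eq_one_or_neg_one hc with h | h <;> simp [h]
  · rw [smul_mul_smul_comm, tensorN_mul, funext h, tensorN_smul, smul_smul]

theorem exists_mul_eq_one_of_mem_PauliGroup {n : ℕ} {M : Mat n} (hM : M ∈ PauliGroup n) :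
    ∃ N ∈ PauliGroup n, M * N = 1 := by
  obtain ⟨a, ha, P, hP, rfl⟩ := mem_PauliGroup_iff.1 hM
  choose c hc h using fun i => pauliSet_mul_self (hP i)
  have hd := prod_eq_one_or_neg_one hc
  refine ⟨(a * ∏ i, c i) • tensorN P, mem_PauliGroup_iff.2 ⟨_, ?_, P, hP, rfl⟩, ?_⟩
  · rcases ha with rfl | rfl <;> rcases hd with h | h <;> simp [h]
  · rw [smul_mul_smul_comm, tensorN_mul, funext h, tensorN_smul, tensorN_one, smul_smul]
    rcases ha with rfl | rfl <;> rcases hd with h | h <;> simp [h]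

theorem exists_unit_of_mem_PauliGroup {n : ℕ} {M : Mat n} (hM : M ∈ PauliGroup n) :
    ∃ U : PauliUnits n, ((U : (Mat n)ˣ) : Mat n) = M := by
  obtain ⟨N, -, h⟩ := exists_mul_eq_one_of_mem_PauliGroup hM
  exact ⟨⟨⟨M, N, h, mul_eq_one_comm.1 h⟩, Subgroup.subset_closure hM⟩, rfl⟩

theorem val_mem_PauliGroup {n : ℕ} {U : (Mat n)ˣ} (hU : U ∈ PauliUnits n) :
    (U : Mat n) ∈ PauliGroup n := by
  induction hU using Subgroup.closure_induction with
  | mem _ h => exact h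
  | one => exact one_mem_PauliGroup
  | mul _ _ _ _ hx hy => exact mul_mem_PauliGroup hx hy
  | inv x _ hx =>
    obtain ⟨N, hN, h⟩ := exists_mul_eq_one_of_mem_PauliGroup hx
    rwa [Units.inv_eq_of_mul_eq_one_right h]

theorem kronLast_mem_PauliGroup {m : ℕ} (hn : 1 ≤ m + 1) {A : Mat m} (hA : A ∈ PauliGroup m)
    {S : Matrix (Fin 2) (Fin 2) ℝ} (hS : S ∈ pauliSet) :
    kronLast hn A S ∈ PauliGroup (m + 1) := by
  obtain ⟨a, ha, P, hP, rfl⟩ := mem_PauliGroup_iff.1 hA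
  refine mem_PauliGroup_iff.2 ⟨a, ha, Fin.snoc (α := fun _ => _) P S, ?_, ?_⟩
  · intro i
    induction i using Fin.lastCases with
    | last => simpa using hS
    | cast i => simpa using hP i
  · rw [tensorN_succ hn, smul_kronLast]
    simp

theorem exists_eq_kronLast {m : ℕ} (hn : 1 ≤ m + 1) {M : Mat (m + 1)}
    (hM : M ∈ PauliGroup (m + 1)) :
    ∃ A ∈ PauliGroup m, ∃ S ∈ pauliSet, M = kronLast hn A S := by
  obtain ⟨a, ha, P, hP, rfl⟩ := mem_PauliGroup_iff.1 hM
  exact ⟨_, mem_PauliGroup_iff.2 ⟨a, ha, fun i => P i.castSucc, fun i => hP _, rfl⟩,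
    P (Fin.last m), hP _, by rw [smul_kronLast, tensorN_succ hn]; rfl⟩

/-- The ring-level embedding `A ↦ A ⊗ I`, as a monoid homomorphism. -/
def kronLastOneHom (m : ℕ) : Mat m →* Mat (m + 1) where
  toFun A := kronLast (Nat.le_add_left 1 m) A 1
  map_one' := kronLast_one _
  map_mul' A B := by rw [← kronLast_mul, mul_one]

/-- The embedding `R ↦ R ⊗ I` of the `m`-qubit Pauli group in the `(m + 1)`-qubit one. -/
def pauliEmb (m : ℕ) : PauliUnits m →* PauliUnits (m + 1) :=
  ((Units.map (kronLastOneHom m)).comp (PauliUnits m).subtype).codRestrict (PauliUnits (m + 1))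
    fun R => Subgroup.subset_closure
      (kronLast_mem_PauliGroup (Nat.le_add_left 1 m) (val_mem_PauliGroup R.2) (Or.inl rfl))

theorem coe_pauliEmb {m : ℕ} (hn : 1 ≤ m + 1) (R : PauliUnits m) :
    ((pauliEmb m R : (Mat (m + 1))ˣ) : Mat (m + 1)) = kronLast hn ((R : (Mat m)ˣ) : Mat m) 1 :=
  rfl

theorem pauliEmb_injective (m : ℕ) : Function.Injective (pauliEmb m) := fun _ _ h =>
  Subtype.ext <| Units.ext <| kronLast_one_right_injective (Nat.le_add_left 1 m) <|
    congrArg (fun U : PauliUnits (m + 1) => ((U : (Mat (m + 1))ˣ) : Mat (m + 1))) h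

theorem coe_injective {n : ℕ} {U V : PauliUnits n}
    (h : ((U : (Mat n)ˣ) : Mat n) = ((V : (Mat n)ˣ) : Mat n)) : U = V :=
  Subtype.ext (Units.ext h)

theorem range_pauliEmb {m : ℕ} {x z : PauliUnits (m + 1)}
    (hx : ((x : (Mat (m + 1))ˣ) : Mat (m + 1)) = lastX (m + 1))
    (hz : ((z : (Mat (m + 1))ˣ) : Mat (m + 1)) = lastZ (m + 1)) :
    (pauliEmb m).range = Subgroup.centralizer {x, z} := by
  have hn : 1 ≤ m + 1 := Nat.le_add_left 1 m
  rw [lastX_succ hn] at hx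
  rw [lastZ_succ hn] at hz
  ext g
  simp only [MonoidHom.mem_range, Subgroup.mem_centralizer_iff, Set.mem_insert_iff,
    Set.mem_singleton_iff, forall_eq_or_imp, forall_eq]
  constructor
  · rintro ⟨R, rfl⟩
    constructor <;> apply coe_injective <;>
      simp only [Subgroup.coe_mul, Units.val_mul, hx, hz, coe_pauliEmb hn, ← kronLast_mul,
        one_mul, mul_one]
  · rintro ⟨hgx, hgz⟩
    obtain ⟨A, hA, S, hS, hg⟩ := exists_eq_kronLast hn (val_mem_PauliGroup g.2)
    obtain ⟨R, rfl⟩ := exists_unit_of_mem_PauliGroup hA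
    have hR : ((R : (Mat m)ˣ) : Mat m) ≠ 0 := (R : (Mat m)ˣ).ne_zero
    have hcomm : ∀ {w : PauliUnits (m + 1)} {T : Matrix (Fin 2) (Fin 2) ℝ},
        ((w : (Mat (m + 1))ˣ) : Mat (m + 1)) = kronLast hn 1 T → w * g = g * w →
          S * T = T * S := by
      intro w T hw h
      apply kronLast_right_injective hn hR
      have h' : ((w : (Mat (m + 1))ˣ) : Mat (m + 1)) * ((g : (Mat (m + 1))ˣ) : Mat (m + 1)) =
          ((g : (Mat (m + 1))ˣ) : Mat (m + 1)) * ((w : (Mat (m + 1))ˣ) : Mat (m + 1)) :=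
        congrArg (fun U : PauliUnits (m + 1) => ((U : (Mat (m + 1))ˣ) : Mat (m + 1))) h
      rw [hw, hg, ← kronLast_mul, ← kronLast_mul, one_mul, mul_one] at h'
      exact h'.symm
    obtain rfl := eq_one_of_mem_pauliSet_of_commute hS (hcomm hx hgx) (hcomm hz hgz)
    exact ⟨R, coe_injective hg.symm⟩

theorem map_centralizer_of_fixed {G : Type*} [Group G] (φ : MulAut G) {s : Set G}
    (h : ∀ x ∈ s, φ x = x) :
    (Subgroup.centralizer s).map φ.toMonoidHom = Subgroup.centralizer s := by
  ext g
  rw [Subgroup.mem_map_equiv, Subgroup.mem_centralizer_iff, Subgroup.mem_centralizer_iff]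
  refine forall₂_congr fun x hx => ?_
  rw [← φ.injective.eq_iff, map_mul, map_mul, MulEquiv.apply_symm_apply, h x hx]

/-- An automorphism preserving the range of an injective homomorphism restricts along it. -/
theorem exists_mulAut_comp_eq {H G : Type*} [Group H] [Group G] {f : H →* G}
    (hf : Function.Injective f) (φ : MulAut G) (h : f.range.map φ.toMonoidHom = f.range) :
    ∃ ψ : MulAut H, ∀ x, f (ψ x) = φ (f x) := by
  let e := MonoidHom.ofInjective hf
  refine ⟨e.trans (((φ.subgroupMap f.range).trans (MulEquiv.subgroupCongr h)).trans e.symm),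
    fun x => ?_⟩
  exact congrArg Subtype.val (e.apply_symm_apply _)

theorem exists_mulAut_kronLast (m : ℕ) (hn : 1 ≤ m + 1) (φ : MulAut ↥(PauliUnits (m + 1)))
    {x z : PauliUnits (m + 1)} (hx : ((x : (Mat (m + 1))ˣ) : Mat (m + 1)) = lastX (m + 1))
    (hz : ((z : (Mat (m + 1))ˣ) : Mat (m + 1)) = lastZ (m + 1)) (hφx : φ x = x) (hφz : φ z = z) :
    ∃ φ'' : MulAut ↥(PauliUnits m),
      ∀ (P : ↥(PauliUnits (m + 1))) (R : ↥(PauliUnits m))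
        (S : Matrix (Fin 2) (Fin 2) ℝ), S ∈ pauliSet →
        ((P : (Mat (m + 1))ˣ) : Mat (m + 1)) = kronLast hn ((R : (Mat m)ˣ) : Mat m) S →
        ((φ P : (Mat (m + 1))ˣ) : Mat (m + 1)) =
          kronLast hn ((φ'' R : (Mat m)ˣ) : Mat m) S := by
  obtain ⟨ψ, hψ⟩ := exists_mulAut_comp_eq (pauliEmb_injective m) φ <| by
    rw [range_pauliEmb hx hz]
    exact map_centralizer_of_fixed φ (by simp [hφx, hφz])
  refine ⟨ψ, fun P R S hS hP => ?_⟩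
  rw [lastX_succ hn] at hx
  rw [lastZ_succ hn] at hz
  obtain ⟨s, hs, hφs⟩ : ∃ s : PauliUnits (m + 1),
      ((s : (Mat (m + 1))ˣ) : Mat (m + 1)) = kronLast hn 1 S ∧ φ s = s := by
    rcases hS with rfl | rfl | rfl | rfl
    · exact ⟨1, (kronLast_one hn).symm, map_one φ⟩
    · exact ⟨x, hx, hφx⟩
    · exact ⟨z, hz, hφz⟩
    · refine ⟨x * z, ?_, by rw [map_mul, hφx, hφz]⟩
      rw [Subgroup.coe_mul, Units.val_mul, hx, hz, ← kronLast_mul, one_mul]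
  obtain rfl : P = pauliEmb m R * s := coe_injective <| by
    rw [hP, Subgroup.coe_mul, Units.val_mul, hs, coe_pauliEmb hn, ← kronLast_mul, one_mul, mul_one]
  rw [map_mul, hφs, ← hψ, Subgroup.coe_mul, Units.val_mul, hs, coe_pauliEmb hn, ← kronLast_mul,
    one_mul, mul_one]

/-- For `n ≥ 1`, if an automorphism `φ` of `P_n` fixes both
`I^{⊗(n−1)} ⊗ Z` and `I^{⊗(n−1)} ⊗ X`, then there is an automorphism `φ''` of `P_{n−1}`
with `φ(R ⊗ S) = φ''(R) ⊗ S` for every `R ∈ P_{n−1}` and `S ∈ {I, X, Z, XZ}`. -/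
theorem aut_fixing_last_factors (n : ℕ) (hn : 1 ≤ n) (φ : MulAut ↥(PauliUnits n))
    (hZ : ∀ P : ↥(PauliUnits n),
      ((P : (Mat n)ˣ) : Mat n) = lastZ n → ((φ P : (Mat n)ˣ) : Mat n) = lastZ n)
    (hX : ∀ P : ↥(PauliUnits n),
      ((P : (Mat n)ˣ) : Mat n) = lastX n → ((φ P : (Mat n)ˣ) : Mat n) = lastX n) :
    ∃ φ'' : MulAut ↥(PauliUnits (n - 1)),
      ∀ (P : ↥(PauliUnits n)) (R : ↥(PauliUnits (n - 1)))
        (S : Matrix (Fin 2) (Fin 2) ℝ), S ∈ pauliSet →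
        ((P : (Mat n)ˣ) : Mat n) = kronLast hn ((R : (Mat (n - 1))ˣ) : Mat (n - 1)) S →
        ((φ P : (Mat n)ˣ) : Mat n) =
          kronLast hn ((φ'' R : (Mat (n - 1))ˣ) : Mat (n - 1)) S := by
  obtain ⟨m, rfl⟩ : ∃ m, n = m + 1 := ⟨n - 1, by omega⟩
  obtain ⟨x, hx⟩ : ∃ x : PauliUnits (m + 1),
      ((x : (Mat (m + 1))ˣ) : Mat (m + 1)) = lastX (m + 1) :=
    exists_unit_of_mem_PauliGroup <| lastX_succ hn ▸
      kronLast_mem_PauliGroup hn one_mem_PauliGroup (by simp [pauliSet])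
  obtain ⟨z, hz⟩ : ∃ z : PauliUnits (m + 1),
      ((z : (Mat (m + 1))ˣ) : Mat (m + 1)) = lastZ (m + 1) :=
    exists_unit_of_mem_PauliGroup <| lastZ_succ hn ▸
      kronLast_mem_PauliGroup hn one_mem_PauliGroup (by simp [pauliSet])
  exact exists_mulAut_kronLast m hn φ hx hz (coe_injective ((hX x hx).trans hx.symm))
    (coe_injective ((hZ z hz).trans hz.symm))

end RealStab

end
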